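/- arXiv:0912.0718 — 3 statements merged into one kernel-verified Lean document; each statement's English description precedes it below -/
import Mathlib

section
/- Let f₁, f₂ be non-constant meromorphic functions on ℂ whose associated densities ρ_{f₁} = 4|f₁′|²/(1+|f₁|²)² and ρ_{f₂} = 4|f₂′|²/(1+|f₂|²)² are equal. Then there exists a matrix γ = [[a,b],[c,d]] ∈ SU(2) such that f₁ = (a f₂ + b)/(c f₂ + d). -/
/-- The spherical density associated with a function f. -/
noncomputable def sphericalDensity (f : ℂ → ℂ) (z : ℂ) : ℝ :=
  4 * ‖deriv f z‖ ^ 2 / (1 + ‖f z‖ ^ 2) ^ 2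

open Complex Metric in
/-- A holomorphic function on a ball around 0 vanishing at real points vanishes. -/
lemma real_zero {g : ℂ → ℂ} {R : ℝ} (hR : 0 < R) (hg : DifferentiableOn ℂ g (Metric.ball 0 R))
    (h0 : ∀ t : ℝ, |t| < R → g t = 0) : ∀ z ∈ Metric.ball (0 : ℂ) R, g z = 0 := by
  have han : AnalyticOnNhd ℂ g (Metric.ball 0 R) := hg.analyticOnNhd Metric.isOpen_ball
  have hfr : ∃ᶠ z in nhdsWithin (0 : ℂ) {0}ᶜ, g z = 0 := by
    have ht : Filter.Tendsto (fun t : ℝ => (t : ℂ)) (nhdsWithin 0 {0}ᶜ)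
        (nhdsWithin (0 : ℂ) {0}ᶜ) := by
      apply tendsto_nhdsWithin_of_tendsto_nhds_of_eventually_within
      · have : Filter.Tendsto (fun t : ℝ => (t : ℂ)) (nhds 0) (nhds ((0 : ℝ) : ℂ)) :=
          Complex.continuous_ofReal.tendsto 0
        simpa using this.mono_left nhdsWithin_le_nhds
      · filter_upwards [self_mem_nhdsWithin] with t ht
        simpa using ht
    apply ht.frequently
    apply Filter.Eventually.frequently
    have : ∀ᶠ t : ℝ in nhds 0, |t| < R := by
      filter_upwards [Metric.ball_mem_nhds (0 : ℝ) hR] with t ht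
      simpa using ht
    filter_upwards [nhdsWithin_le_nhds this] with t ht using h0 t ht
  have := han.eqOn_zero_of_preconnected_of_frequently_eq_zero
    (convex_ball _ _).isPreconnected (Metric.mem_ball_self hR) hfr
  intro z hz
  exact this hz

open ComplexConjugate in
lemma polar {F : ℂ → ℂ → ℂ} {r : ℝ} (hr : 0 < r)
    (hF : ∀ p ∈ Metric.ball (0 : ℂ) r, ∀ q ∈ Metric.ball (0 : ℂ) r,
      DifferentiableAt ℂ (fun x : ℂ × ℂ => F x.1 x.2) (p, q))
    (h0 : ∀ p ∈ Metric.ball (0 : ℂ) r, F p (conj p) = 0) :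
    ∀ p ∈ Metric.ball (0 : ℂ) r, F p 0 = 0 := by
  have hmem : ∀ x ∈ Metric.ball (0 : ℂ) (r/2), ∀ y ∈ Metric.ball (0 : ℂ) (r/2),
      x + Complex.I * y ∈ Metric.ball (0 : ℂ) r ∧ x - Complex.I * y ∈ Metric.ball (0 : ℂ) r := by
    intro x hx y hy
    simp only [mem_ball_zero_iff] at *
    have h1 := norm_add_le x (Complex.I * y)
    have h2 := norm_sub_le x (Complex.I * y)
    simp only [norm_mul, Complex.norm_I, one_mul] at h1 h2
    constructor <;> linarith
  have hG : ∀ x ∈ Metric.ball (0 : ℂ) (r/2), ∀ y ∈ Metric.ball (0 : ℂ) (r/2),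
      DifferentiableAt ℂ (fun s : ℂ × ℂ => F (s.1 + Complex.I * s.2) (s.1 - Complex.I * s.2))
        (x, y) := by
    intro x hx y hy
    have h := hF _ (hmem x hx y hy).1 _ (hmem x hx y hy).2
    exact DifferentiableAt.comp (x, y)
      (f := fun s : ℂ × ℂ => (s.1 + Complex.I * s.2, s.1 - Complex.I * s.2)) h (by fun_prop)
  have hr2 : 0 < r / 2 := by linarith
  have hreal : ∀ t : ℝ, |t| < r / 2 → (t : ℂ) ∈ Metric.ball (0 : ℂ) (r/2) := by
    intro t ht; simpa using ht
  have step1 : ∀ y : ℝ, |y| < r / 2 → ∀ x ∈ Metric.ball (0 : ℂ) (r/2),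
      F (x + Complex.I * y) (x - Complex.I * y) = 0 := by
    intro y hy
    apply real_zero hr2 (g := fun x => F (x + Complex.I * y) (x - Complex.I * y))
    · intro x hx
      apply DifferentiableAt.differentiableWithinAt
      exact DifferentiableAt.comp x (f := fun x : ℂ => (x, (y : ℂ))) (hG x hx y (hreal y hy))
        (by fun_prop)
    · intro t ht
      have := h0 _ (hmem t (hreal t ht) y (hreal y hy)).1
      simpa [sub_eq_add_neg] using this
  have step2 : ∀ x ∈ Metric.ball (0 : ℂ) (r/2), ∀ y ∈ Metric.ball (0 : ℂ) (r/2),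
      F (x + Complex.I * y) (x - Complex.I * y) = 0 := by
    intro x hx
    apply real_zero hr2 (g := fun y => F (x + Complex.I * y) (x - Complex.I * y))
    · intro y hy
      apply DifferentiableAt.differentiableWithinAt
      exact DifferentiableAt.comp y (f := fun y : ℂ => (x, y)) (hG x hx y hy)
        (by fun_prop)
    · intro t ht
      exact step1 t ht x hx
  intro p hp
  have hp' : ‖p‖ < r := by simpa using hp
  have := step2 (p / 2) (by simp; linarith) (-Complex.I * p / 2) (by simp; linarith)
  have e1 : p / 2 + Complex.I * (-Complex.I * p / 2) = p := by
    linear_combination (-p / 2) * Complex.I_mul_I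
  have e2 : p / 2 - Complex.I * (-Complex.I * p / 2) = 0 := by
    linear_combination (p / 2) * Complex.I_mul_I
  rwa [e1, e2] at this

open ComplexConjugate in
lemma diff_star {g : ℂ → ℂ} {z0 q : ℂ} (h : DifferentiableAt ℂ g (z0 + conj q)) :
    DifferentiableAt ℂ (fun q => conj (g (z0 + conj q))) q := by
  have h1 : DifferentiableAt ℂ (fun s => g (z0 + s)) (conj q) :=
    DifferentiableAt.comp (conj q) (f := fun s => z0 + s) h (by fun_prop)
  have := h1.conj_conj
  simpa [Function.comp_def] using this

open ComplexConjugate in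
lemma density_cross {f₁ f₂ : ℂ → ℂ} {z : ℂ} (h : sphericalDensity f₁ z = sphericalDensity f₂ z) :
    ‖deriv f₁ z‖ * (1 + ‖f₂ z‖ ^ 2) = ‖deriv f₂ z‖ * (1 + ‖f₁ z‖ ^ 2) := by
  unfold sphericalDensity at h
  have p1 : 0 < 1 + ‖f₁ z‖ ^ 2 := by positivity
  have p2 : 0 < 1 + ‖f₂ z‖ ^ 2 := by positivity
  rw [div_eq_div_iff (by positivity) (by positivity)] at h
  have : (‖deriv f₁ z‖ * (1 + ‖f₂ z‖ ^ 2)) ^ 2 = (‖deriv f₂ z‖ * (1 + ‖f₁ z‖ ^ 2)) ^ 2 := by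
    linarith
  exact (sq_eq_sq₀ (by positivity) (by positivity)).1 this

open ComplexConjugate in
lemma local_polar {f₁ f₂ : ℂ → ℂ} {z0 : ℂ} {r : ℝ} (hr : 0 < r)
    (h₁ : ∀ z ∈ Metric.ball z0 r, AnalyticAt ℂ f₁ z)
    (h₂ : ∀ z ∈ Metric.ball z0 r, AnalyticAt ℂ f₂ z)
    (h : ∀ z ∈ Metric.ball z0 r, sphericalDensity f₁ z = sphericalDensity f₂ z) :
    ∀ z ∈ Metric.ball z0 r,
      deriv f₁ z * conj (deriv f₁ z0) * (1 + f₂ z * conj (f₂ z0)) ^ 2 =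
      deriv f₂ z * conj (deriv f₂ z0) * (1 + f₁ z * conj (f₁ z0)) ^ 2 := by
  have hb : ∀ p ∈ Metric.ball (0 : ℂ) r, z0 + p ∈ Metric.ball z0 r := by
    intro p hp; simpa [dist_eq_norm] using hp
  have hbc : ∀ p ∈ Metric.ball (0 : ℂ) r, z0 + conj p ∈ Metric.ball z0 r := by
    intro p hp; simpa [dist_eq_norm] using hp
  have key := polar (r := r) (F := fun p q =>
      deriv f₁ (z0 + p) * conj (deriv f₁ (z0 + conj q)) *
        (1 + f₂ (z0 + p) * conj (f₂ (z0 + conj q))) ^ 2 -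
      deriv f₂ (z0 + p) * conj (deriv f₂ (z0 + conj q)) *
        (1 + f₁ (z0 + p) * conj (f₁ (z0 + conj q))) ^ 2) hr ?_ ?_
  · intro z hz
    have := key (z - z0) (by simpa [dist_eq_norm] using hz)
    simp only [map_zero, add_zero, add_sub_cancel] at this
    exact sub_eq_zero.1 this
  · intro p hp q hq
    have D1 : ∀ g : ℂ → ℂ, AnalyticAt ℂ g (z0 + p) →
        DifferentiableAt ℂ (fun x : ℂ × ℂ => g (z0 + x.1)) (p, q) := by
      intro g hg
      exact DifferentiableAt.comp (p, q) (f := fun x : ℂ × ℂ => z0 + x.1)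
        hg.differentiableAt (by fun_prop)
    have D2 : ∀ g : ℂ → ℂ, AnalyticAt ℂ g (z0 + conj q) →
        DifferentiableAt ℂ (fun x : ℂ × ℂ => conj (g (z0 + conj x.2))) (p, q) := by
      intro g hg
      exact DifferentiableAt.comp (p, q) (f := fun x : ℂ × ℂ => x.2)
        (diff_star hg.differentiableAt) (by fun_prop)
    have a1 := D1 _ (h₁ _ (hb p hp))
    have a2 := D1 _ (h₂ _ (hb p hp))
    have a3 := D1 _ (h₁ _ (hb p hp)).deriv
    have a4 := D1 _ (h₂ _ (hb p hp)).deriv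
    have b1 := D2 _ (h₁ _ (hbc q hq))
    have b2 := D2 _ (h₂ _ (hbc q hq))
    have b3 := D2 _ (h₁ _ (hbc q hq)).deriv
    have b4 := D2 _ (h₂ _ (hbc q hq)).deriv
    exact ((a3.mul b3).mul (((a2.mul b2).const_add 1).pow 2)).sub
      ((a4.mul b4).mul (((a1.mul b1).const_add 1).pow 2))
  · intro p hp
    have e := density_cross (h _ (hb p hp))
    simp only [Complex.conj_conj, Complex.mul_conj']
    have e' : ((‖deriv f₁ (z0 + p)‖ : ℂ)) * (1 + (‖f₂ (z0 + p)‖ : ℂ) ^ 2) =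
        (‖deriv f₂ (z0 + p)‖ : ℂ) * (1 + (‖f₁ (z0 + p)‖ : ℂ) ^ 2) := by
      exact_mod_cast e
    rw [← mul_pow, ← mul_pow, e', sub_self]

open ComplexConjugate in
lemma local_rel {f₁ f₂ : ℂ → ℂ} {z0 : ℂ} {r : ℝ} (hr : 0 < r)
    (h₁ : ∀ z ∈ Metric.ball z0 r, AnalyticAt ℂ f₁ z)
    (h₂ : ∀ z ∈ Metric.ball z0 r, AnalyticAt ℂ f₂ z)
    (h : ∀ z ∈ Metric.ball z0 r, sphericalDensity f₁ z = sphericalDensity f₂ z)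
    (hd : deriv f₁ z0 ≠ 0) :
    ∃ u : ℂ, ‖u‖ = 1 ∧ ∀ᶠ z in nhds z0,
      (f₁ z - f₁ z0) * (1 + conj (f₂ z0) * f₂ z) =
        u * ((f₂ z - f₂ z0) * (1 + conj (f₁ z0) * f₁ z)) := by
  have hz0 : z0 ∈ Metric.ball z0 r := Metric.mem_ball_self hr
  have pol := local_polar hr h₁ h₂ h
  have e0 := density_cross (h z0 hz0)
  have pos : ∀ A : ℂ, 1 + conj A * A ≠ 0 := by
    intro A
    rw [Complex.conj_mul']
    have : (1 + ‖A‖ ^ 2 : ℝ) ≠ 0 := by positivity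
    exact_mod_cast this
  have npos : ∀ A : ℂ, ‖1 + conj A * A‖ = 1 + ‖A‖ ^ 2 := by
    intro A
    rw [Complex.conj_mul']
    have h1 : (1 + (‖A‖ : ℂ) ^ 2) = ((1 + ‖A‖ ^ 2 : ℝ) : ℂ) := by push_cast; rfl
    rw [h1, Complex.norm_real, Real.norm_of_nonneg (by positivity)]
  have n1 : ∀ᶠ z in nhds z0, 1 + conj (f₁ z0) * f₁ z ≠ 0 :=
    ((((h₁ z0 hz0).continuousAt).const_mul (conj (f₁ z0))).const_add 1).eventually_ne (pos _)
  have n2 : ∀ᶠ z in nhds z0, 1 + conj (f₂ z0) * f₂ z ≠ 0 :=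
    ((((h₂ z0 hz0).continuousAt).const_mul (conj (f₂ z0))).const_add 1).eventually_ne (pos _)
  obtain ⟨s, hs, hball⟩ := Metric.eventually_nhds_iff_ball.1
    ((n1.and n2).and (Metric.ball_mem_nhds z0 hr))
  set β₁ := conj (deriv f₁ z0) / (1 + conj (f₁ z0) * f₁ z0) with hβ₁
  set β₂ := conj (deriv f₂ z0) / (1 + conj (f₂ z0) * f₂ z0) with hβ₂
  have hβ₁0 : β₁ ≠ 0 := div_ne_zero (by simpa using hd) (pos _)
  have hnorm : ‖β₁‖ = ‖β₂‖ := by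
    rw [hβ₁, hβ₂, norm_div, norm_div, npos, npos, RCLike.norm_conj, RCLike.norm_conj,
      div_eq_div_iff (by positivity) (by positivity)]
    exact e0
  have hder : ∀ f : ℂ → ℂ, ∀ z, AnalyticAt ℂ f z → 1 + conj (f z0) * f z ≠ 0 →
      HasDerivAt (fun z => (conj (deriv f z0) / (1 + conj (f z0) * f z0)) *
        ((f z - f z0) / (1 + conj (f z0) * f z)))
        (deriv f z * conj (deriv f z0) / (1 + conj (f z0) * f z) ^ 2) z := by
    intro f z hf hne
    have d := hf.differentiableAt.hasDerivAt
    have := ((d.sub_const (f z0)).div ((d.const_mul (conj (f z0))).const_add 1) hne).const_mul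
      (conj (deriv f z0) / (1 + conj (f z0) * f z0))
    convert! this using 1
    have := pos (f z0)
    field_simp
    ring
  have hE : ∀ z ∈ Metric.ball z0 s, HasDerivAt (fun z =>
      β₁ * ((f₁ z - f₁ z0) / (1 + conj (f₁ z0) * f₁ z)) -
      β₂ * ((f₂ z - f₂ z0) / (1 + conj (f₂ z0) * f₂ z))) 0 z := by
    intro z hz
    obtain ⟨⟨m1, m2⟩, mb⟩ := hball z hz
    have := (hder f₁ z (h₁ z mb) m1).sub (hder f₂ z (h₂ z mb) m2)
    convert! this using 1
    rw [eq_comm, sub_eq_zero, div_eq_div_iff (pow_ne_zero 2 m1) (pow_ne_zero 2 m2)]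
    have := pol z mb
    rw [mul_comm (conj (f₂ z0)), mul_comm (conj (f₁ z0))]
    exact this
  have hconst : ∀ z ∈ Metric.ball z0 s,
      β₁ * ((f₁ z - f₁ z0) / (1 + conj (f₁ z0) * f₁ z)) -
      β₂ * ((f₂ z - f₂ z0) / (1 + conj (f₂ z0) * f₂ z)) = 0 := by
    intro z hz
    have := Metric.isOpen_ball.is_const_of_deriv_eq_zero (convex_ball z0 s).isPreconnected
      (fun z hz => (hE z hz).differentiableAt.differentiableWithinAt)
      (fun z hz => (hE z hz).deriv) hz (Metric.mem_ball_self hs)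
    simpa using this
  refine ⟨β₂ / β₁, ?_, ?_⟩
  · rw [norm_div, ← hnorm, div_self (by simpa using hβ₁0)]
  · filter_upwards [Metric.ball_mem_nhds z0 hs] with z hz
    obtain ⟨⟨m1, m2⟩, mb⟩ := hball z hz
    have := hconst z hz
    clear_value β₁ β₂
    rw [sub_eq_zero, ← mul_div_assoc, ← mul_div_assoc, div_eq_div_iff m1 m2] at this
    rw [div_mul_eq_mul_div, eq_div_iff hβ₁0]
    linear_combination this

open ComplexConjugate in
lemma exists_gamma (A B u : ℂ) (hu : ‖u‖ = 1) :
    ∃ γ ∈ Matrix.specialUnitaryGroup (Fin 2) ℂ, ∀ x y : ℂ,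
      (x - A) * (1 + conj B * y) = u * ((y - B) * (1 + conj A * x)) →
      x * (γ 1 0 * y + γ 1 1) = γ 0 0 * y + γ 0 1 := by
  obtain ⟨v, hv⟩ := IsAlgClosed.exists_pow_nat_eq u (n := 2) (by norm_num)
  have hvn : ‖v‖ = 1 := by
    have : ‖v‖ ^ 2 = 1 := by rw [← norm_pow, hv, hu]
    exact (pow_eq_one_iff_of_nonneg (norm_nonneg v) (by norm_num)).1 this
  have hvv : v * conj v = 1 := by rw [Complex.mul_conj', hvn]; simp
  have hS : 0 < (1 + ‖A‖ ^ 2) * (1 + ‖B‖ ^ 2) := by positivity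
  set s : ℝ := Real.sqrt ((1 + ‖A‖ ^ 2) * (1 + ‖B‖ ^ 2)) with hs
  have hs0 : (s : ℂ) ≠ 0 := by
    exact_mod_cast (Real.sqrt_pos.2 hS).ne'
  have hs2 : (s : ℂ) * s = (1 + A * conj A) * (1 + B * conj B) := by
    rw [Complex.mul_conj', Complex.mul_conj']
    have := Real.mul_self_sqrt hS.le
    exact_mod_cast this
  clear_value s
  set a : ℂ := (v + A * conj B * conj v) / s with ha
  set b : ℂ := (A * conj v - v * B) / s with hb
  have hca : conj a = (conj v + conj A * B * v) / s := by simp [ha]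
  have hcb : conj b = (conj A * v - conj v * conj B) / s := by simp [hb]
  have hdet : a * conj a + b * conj b = 1 := by
    rw [hca, hcb, ha, hb]
    field_simp
    linear_combination ((1 + A * conj A) * (1 + B * conj B)) * hvv - hs2
  refine ⟨!![a, b; -conj b, conj a], ?_, ?_⟩
  · rw [Matrix.mem_specialUnitaryGroup_iff, Matrix.mem_unitaryGroup_iff]
    constructor
    · ext i j
      fin_cases i <;> fin_cases j <;>
        simp [Matrix.mul_apply, Fin.sum_univ_two, Matrix.star_apply]
      · exact hdet
      · ring
      · ring
      · linear_combination hdet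
    · rw [Matrix.det_fin_two_of]
      linear_combination hdet
  · intro x y hxy
    simp only [Matrix.of_apply, Matrix.cons_val', Matrix.cons_val_zero, Matrix.cons_val_one,
      Matrix.cons_val_fin_one]
    rw [hca, hcb, ha, hb]
    field_simp
    rw [← hv] at hxy
    linear_combination conj v * hxy + v * (y - B) * (1 + conj A * x) * hvv

/-- If two non-constant meromorphic functions on ℂ have equal associated densities,
then they are related by an SU(2) Möbius transformation. -/
theorem equal_densities_implies_SU2_related
    (f₁ f₂ : ℂ → ℂ)
    (hmero₁ : MeromorphicOn f₁ Set.univ) (hmero₂ : MeromorphicOn f₂ Set.univ)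
    (hnc₁ : ¬ ∃ c, ∀ z, f₁ z = c) (hnc₂ : ¬ ∃ c, ∀ z, f₂ z = c)
    (heq : ∀ z, DifferentiableAt ℂ f₁ z → DifferentiableAt ℂ f₂ z →
      sphericalDensity f₁ z = sphericalDensity f₂ z) :
    ∃ γ ∈ Matrix.specialUnitaryGroup (Fin 2) ℂ,
      ∀ z, DifferentiableAt ℂ f₁ z → DifferentiableAt ℂ f₂ z →
        γ 1 0 * f₂ z + γ 1 1 ≠ 0 →
        f₁ z = (γ 0 0 * f₂ z + γ 0 1) / (γ 1 0 * f₂ z + γ 1 1) := by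
  set U : Set ℂ := {z | AnalyticAt ℂ f₁ z} ∩ {z | AnalyticAt ℂ f₂ z} with hU
  have hopen : IsOpen U := (isOpen_analyticAt ℂ f₁).inter (isOpen_analyticAt ℂ f₂)
  have hconn : IsConnected U := by
    have c1 := hmero₁.countable_compl_analyticAt_inter
    have c2 := hmero₂.countable_compl_analyticAt_inter
    rw [Set.inter_univ] at c1 c2
    have := Set.Countable.isConnected_compl_of_one_lt_rank (E := ℂ)
      (by simp) (c1.union c2)
    rwa [Set.compl_union, compl_compl, compl_compl] at this
  have hball : ∀ z0 ∈ U, ∃ r > 0, Metric.ball z0 r ⊆ U := fun z0 hz0 =>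
    Metric.isOpen_iff.1 hopen z0 hz0
  have hden : ∀ z ∈ U, sphericalDensity f₁ z = sphericalDensity f₂ z := fun z hz =>
    heq z hz.1.differentiableAt hz.2.differentiableAt
  have main : ∃ z0 ∈ U, ∃ A B u : ℂ, ‖u‖ = 1 ∧ ∀ᶠ z in nhds z0,
      (f₁ z - A) * (1 + starRingEnd ℂ B * f₂ z) =
        u * ((f₂ z - B) * (1 + starRingEnd ℂ A * f₁ z)) := by
    by_cases hd : ∃ z0 ∈ U, deriv f₁ z0 ≠ 0
    · obtain ⟨z0, hz0, hd⟩ := hd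
      obtain ⟨r, hr, hsub⟩ := hball z0 hz0
      exact ⟨z0, hz0, f₁ z0, f₂ z0, local_rel hr (fun z hz => (hsub hz).1)
        (fun z hz => (hsub hz).2) (fun z hz => hden z (hsub hz)) hd⟩
    · push Not at hd
      have hd2 : ∀ z ∈ U, deriv f₂ z = 0 := by
        intro z hz
        have := density_cross (hden z hz)
        rw [hd z hz, norm_zero, zero_mul, eq_comm] at this
        have p1 : 1 + ‖f₁ z‖ ^ 2 ≠ 0 := by positivity
        simpa [p1] using this
      obtain ⟨z0, hz0⟩ := hconn.nonempty
      refine ⟨z0, hz0, f₁ z0, f₂ z0, 1, by simp, ?_⟩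
      filter_upwards [hopen.mem_nhds hz0] with z hz
      have k1 := hopen.is_const_of_deriv_eq_zero hconn.isPreconnected
        (fun z hz => hz.1.differentiableAt.differentiableWithinAt) hd hz hz0
      have k2 := hopen.is_const_of_deriv_eq_zero hconn.isPreconnected
        (fun z hz => hz.2.differentiableAt.differentiableWithinAt) hd2 hz hz0
      simp [k1, k2]
  obtain ⟨z0, hz0, A, B, u, hu, hev⟩ := main
  obtain ⟨γ, hγ, hrel⟩ := exists_gamma A B u hu
  refine ⟨γ, hγ, ?_⟩
  have hall : Set.EqOn (fun z => f₁ z * (γ 1 0 * f₂ z + γ 1 1))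
      (fun z => γ 0 0 * f₂ z + γ 0 1) U := by
    refine AnalyticOnNhd.eqOn_of_preconnected_of_eventuallyEq (𝕜 := ℂ) ?_ ?_ hconn.isPreconnected
      hz0 ?_
    · intro z hz
      exact hz.1.mul ((analyticAt_const.mul hz.2).add analyticAt_const)
    · intro z hz
      exact (analyticAt_const.mul hz.2).add analyticAt_const
    · filter_upwards [hev] with z hz using hrel _ _ hz
  intro z hz1 hz2 hne
  rw [eq_div_iff hne]
  exact hall ⟨(hmero₁ z trivial).analyticAt hz1.continuousAt,
    (hmero₂ z trivial).analyticAt hz2.continuousAt⟩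
end

section
/- Every elliptic function f with respect to a lattice Ω can be written as f(z) = R₁(℘(z)) + ℘′(z)·R₂(℘(z)) for rational functions R₁, R₂, where ℘ is the Weierstrass function of Ω. -/
/-- The lattice point m·ω₁ + n·ω₂. -/
noncomputable def latticePt (ω₁ ω₂ : ℂ) (p : ℤ × ℤ) : ℂ := p.1 * ω₁ + p.2 * ω₂

/-- The Weierstrass ℘-function of the lattice ℤω₁ + ℤω₂. -/
noncomputable def wp (ω₁ ω₂ : ℂ) (z : ℂ) : ℂ :=
  1 / z ^ 2 + ∑' p : ℤ × ℤ,
    if p = (0, 0) then 0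
    else 1 / (z - latticePt ω₁ ω₂ p) ^ 2 - 1 / (latticePt ω₁ ω₂ p) ^ 2

open Filter Topology Polynomial

lemma aux_countable_compl {s : Set ℂ} (hs : s ∈ codiscreteWithin (Set.univ : Set ℂ)) :
    sᶜ.Countable := by
  rw [codiscreteWithin_iff_locallyFiniteComplementWithin] at hs
  choose t ht hf using fun z => hs z (Set.mem_univ z)
  obtain ⟨c, hc, hcov⟩ := TopologicalSpace.countable_cover_nhds ht
  have : sᶜ ⊆ ⋃ x ∈ c, (t x ∩ (Set.univ \ s)) := by
    intro x hx
    have hx' : x ∈ ⋃ x ∈ c, t x := by rw [hcov]; trivial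
    simp only [Set.mem_iUnion] at hx' ⊢
    obtain ⟨i, hi, hxi⟩ := hx'
    exact ⟨i, hi, hxi, trivial, hx⟩
  exact (hc.biUnion fun x _ => (hf x).countable).mono this

lemma aux_wp_eq (L : PeriodPair) : wp L.ω₁ L.ω₂ = L.weierstrassP := by
  ext z
  have h := L.hasSum_weierstrassP z
  have h2 := (L.latticeEquivProd.symm.toEquiv.hasSum_iff).2 h
  have h3 := h2.tsum_eq
  have hs := h2.summable
  rw [wp, ← h3, hs.tsum_eq_add_tsum_ite (0, 0)]
  congr 1
  · simp [L.latticeEquiv_symm_apply]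
  · refine tsum_congr fun p => ?_
    split_ifs <;> simp [L.latticeEquiv_symm_apply, latticePt]

/-- even order -/
lemma aux_even_order {h : ℂ → ℂ} (hm : MeromorphicAt h 0) (he : ∀ z, h (-z) = h z) {m : ℤ}
    (hord : meromorphicOrderAt h 0 = m) : Even m := by
  obtain ⟨g, hg, hg0, hev⟩ := (meromorphicOrderAt_eq_int_iff hm).1 hord
  have hneg : Tendsto (fun z : ℂ => -z) (𝓝[≠] 0) (𝓝[≠] 0) := by
    refine tendsto_nhdsWithin_iff.2 ⟨?_, ?_⟩
    · have : Tendsto (fun z : ℂ => -z) (𝓝 0) (𝓝 (-0)) := continuous_neg.tendsto 0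
      rw [neg_zero] at this
      exact this.mono_left nhdsWithin_le_nhds
    · filter_upwards [self_mem_nhdsWithin] with z hz
      simpa using hz
  have hev2 := hneg.eventually hev
  have hgt : Tendsto g (𝓝[≠] 0) (𝓝 (g 0)) := hg.continuousAt.tendsto.mono_left nhdsWithin_le_nhds
  have hgt2 : Tendsto (fun z => (-1 : ℂ) ^ m * g (-z)) (𝓝[≠] 0) (𝓝 ((-1 : ℂ) ^ m * g 0)) :=
    (hgt.comp hneg).const_mul _
  have heq : (fun z => (-1 : ℂ) ^ m * g (-z)) =ᶠ[𝓝[≠] 0] g := by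
    filter_upwards [hev, hev2, self_mem_nhdsWithin] with z h1 h2 hz
    have hz : z ≠ 0 := hz
    rw [he, h1] at h2
    simp only [sub_zero, smul_eq_mul] at h2
    rw [neg_eq_neg_one_mul, mul_zpow] at h2
    have hzm : z ^ m ≠ 0 := zpow_ne_zero _ hz
    apply mul_left_cancel₀ hzm
    rw [h2]; simp only [neg_mul, one_mul]; ring
  have := tendsto_nhds_unique (hgt2.congr' heq) hgt
  have h1 : (-1 : ℂ) ^ m = 1 := mul_right_cancel₀ hg0 (by simpa using this)
  by_contra hodd
  rw [Int.not_even_iff_odd] at hodd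
  rw [hodd.neg_one_zpow] at h1
  norm_num at h1

lemma aux_order_periodic {L : PeriodPair} {h : ℂ → ℂ} (hp : ∀ z, ∀ l ∈ L.lattice, h (z + l) = h z)
    (z l : ℂ) (hl : l ∈ L.lattice) : meromorphicOrderAt h (z + l) = meromorphicOrderAt h z := by
  rw [← meromorphicOrderAt_comp_add_const_eq_meromorphicOrderAt]
  congr 1
  ext x
  exact hp x l hl

lemma aux_entire {L : PeriodPair} {h : ℂ → ℂ} (hm : Meromorphic h)
    (hp : ∀ z, ∀ l ∈ L.lattice, h (z + l) = h z) (ho : ∀ z, 0 ≤ meromorphicOrderAt h z) :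
    ∃ c : ℂ, ∀ᶠ z in codiscreteWithin (Set.univ : Set ℂ), h z = c := by
  have hmo : MeromorphicOn h Set.univ := fun z _ => hm z
  set g := toMeromorphicNFOn h Set.univ with hg
  have hga : ∀ z, AnalyticAt ℂ g z := fun z => by
    rw [← (meromorphicNFOn_toMeromorphicNFOn h Set.univ
      (Set.mem_univ z)).meromorphicOrderAt_nonneg_iff_analyticAt,
      meromorphicOrderAt_toMeromorphicNFOn hmo (Set.mem_univ z)]
    exact ho z
  have hgd : Differentiable ℂ g := fun z => (hga z).differentiableAt
  have hgp : ∀ z w, w ∈ L.lattice → g (z + w) = g z := by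
    intro z w hw
    have e1 : g =ᶠ[𝓝[≠] z] h := hmo.toMeromorphicNFOn_eq_self_on_nhdsNE (Set.mem_univ z)
    have e2 : g =ᶠ[𝓝[≠] (z + w)] h := hmo.toMeromorphicNFOn_eq_self_on_nhdsNE (Set.mem_univ _)
    have ht : Tendsto (fun x => x + w) (𝓝[≠] z) (𝓝[≠] (z + w)) := by
      refine tendsto_nhdsWithin_iff.2 ⟨?_, ?_⟩
      · exact ((continuous_add_const w).tendsto z).mono_left nhdsWithin_le_nhds
      · filter_upwards [self_mem_nhdsWithin] with x hx
        simpa using hx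
    have e3 := ht.eventually e2
    have t1 : Tendsto g (𝓝[≠] z) (𝓝 (g z)) :=
      hgd.continuous.continuousAt.tendsto.mono_left nhdsWithin_le_nhds
    have t2 : Tendsto (fun x => g (x + w)) (𝓝[≠] z) (𝓝 (g (z + w))) :=
      ((hgd.continuous.comp (continuous_add_const w)).continuousAt (x := z)).tendsto.mono_left
        nhdsWithin_le_nhds
    refine tendsto_nhds_unique (t2.congr' ?_) t1
    filter_upwards [e1, e3] with x h1 h3
    rw [h3, h1, hp x w hw]
  have hb := (IsZLattice.isCompact_range_of_periodic L.lattice g hgd.continuous hgp).isBounded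
  refine ⟨g 0, ?_⟩
  filter_upwards [toMeromorphicNFOn_eqOn_codiscrete hmo] with z hz
  rw [hz]
  exact hgd.apply_eq_apply_of_bounded hb z 0

lemma aux_eval_mero (L : PeriodPair) (P : ℂ[X]) :
    Meromorphic (fun z => P.eval (L.weierstrassP z)) := by
  have := L.meromorphic_weierstrassP
  induction P using Polynomial.induction_on' with
  | add p q hp hq => simp only [eval_add]; fun_prop
  | monomial n a => simp only [eval_monomial]; fun_prop

lemma aux_eval_analytic (L : PeriodPair) (P : ℂ[X]) (z : ℂ) (hz : z ∉ L.lattice) :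
    AnalyticAt ℂ (fun z => P.eval (L.weierstrassP z)) z := by
  have := L.analyticOnNhd_weierstrassP z hz
  induction P using Polynomial.induction_on' with
  | add p q hp hq => simp only [eval_add]; fun_prop
  | monomial n a => simp only [eval_monomial]; fun_prop

lemma aux_poly {L : PeriodPair} (n : ℕ) : ∀ {h : ℂ → ℂ} (_ : Meromorphic h)
    (_ : ∀ z, ∀ l ∈ L.lattice, h (z + l) = h z) (_ : ∀ z, h (-z) = h z)
    (_ : ∀ z ∉ L.lattice, 0 ≤ meromorphicOrderAt h z)
    (_ : ((-(2 * n) : ℤ) : WithTop ℤ) ≤ meromorphicOrderAt h 0),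
    ∃ P : ℂ[X], ∀ᶠ z in codiscreteWithin (Set.univ : Set ℂ), h z = P.eval (L.weierstrassP z) := by
  induction n with
  | zero =>
    intro h hm hp he ho h0
    obtain ⟨c, hc⟩ := aux_entire hm hp (fun z => by
      by_cases hz : z ∈ L.lattice
      · have := aux_order_periodic hp 0 z hz
        rw [zero_add] at this
        rw [this]; simpa using h0
      · exact ho z hz)
    exact ⟨C c, by simpa using hc⟩
  | succ n ih =>
    intro h hm hp he ho h0
    set W := L.weierstrassP with hW
    have hWm : Meromorphic W := L.meromorphic_weierstrassP
    have hW0 : meromorphicOrderAt W 0 = ((-2 : ℤ) : WithTop ℤ) :=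
      L.order_weierstrassP 0 (zero_mem _)
    have hWp : meromorphicOrderAt (W ^ (n + 1)) 0 = ((-(2 * (n + 1)) : ℤ) : WithTop ℤ) := by
      rw [meromorphicOrderAt_pow (hWm 0), hW0]
      norm_cast
      push_cast; ring
    have hWpm : MeromorphicAt (W ^ (n + 1)) 0 := (hWm 0).pow _
    have hq : 0 ≤ meromorphicOrderAt (h * (W ^ (n + 1))⁻¹) 0 := by
      rw [meromorphicOrderAt_mul (hm 0) hWpm.inv, meromorphicOrderAt_inv, hWp]
      generalize meromorphicOrderAt h 0 = o at h0
      cases o with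
      | top => simp
      | coe o => norm_cast at h0 ⊢; push_cast at h0; change (0:ℤ) ≤ _; omega
    obtain ⟨c, hc⟩ := tendsto_nhds_of_meromorphicOrderAt_nonneg ((hm 0).mul hWpm.inv) hq
    set k : ℂ → ℂ := fun z => h z - c * W z ^ (n + 1) with hk
    have hkm : Meromorphic k := by
      intro z
      have := hm z; have := hWm z
      fun_prop
    have hqk : 0 < meromorphicOrderAt (k * (W ^ (n + 1))⁻¹) 0 := by
      rw [← tendsto_zero_iff_meromorphicOrderAt_pos ((hkm 0).mul hWpm.inv)]
      have : Tendsto (fun z => (h * (W ^ (n + 1))⁻¹) z - c) (𝓝[≠] 0) (𝓝 0) := by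
        simpa using hc.sub_const c
      refine this.congr' ?_
      have hne := (meromorphicOrderAt_ne_top_iff_eventually_ne_zero (hWm 0)).1 (by simp [hW0])
      filter_upwards [hne] with z hz
      simp only [Pi.mul_apply, Pi.inv_apply, Pi.pow_apply, hk]
      field_simp
    have hke : ∀ z, k (-z) = k z := fun z => by simp [hk, he, hW]
    have hkp : ∀ z, ∀ l ∈ L.lattice, k (z + l) = k z := by
      intro z l hl
      have := L.weierstrassP_add_coe z ⟨l, hl⟩
      simp only at this
      simp only [hk, hp z l hl, hW, this]
    have hk0 : ((-(2 * n) : ℤ) : WithTop ℤ) ≤ meromorphicOrderAt k 0 := by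
      rw [meromorphicOrderAt_mul (hkm 0) hWpm.inv, meromorphicOrderAt_inv, hWp] at hqk
      have hev := fun m => aux_even_order (hkm 0) hke (m := m)
      generalize meromorphicOrderAt k 0 = o at hqk hev
      cases o with
      | top => simp
      | coe o =>
        have ho := hev o rfl
        norm_cast at hqk ⊢
        change (0:ℤ) < _ at hqk
        push_cast
        obtain ⟨r, hr⟩ := ho
        omega
    have hko : ∀ z ∉ L.lattice, 0 ≤ meromorphicOrderAt k z := by
      intro z hz
      have hWa : AnalyticAt ℂ W z := L.analyticOnNhd_weierstrassP z hz
      have ha : AnalyticAt ℂ (fun z => -(c * W z ^ (n + 1))) z := by fun_prop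
      have : k = h + fun z => -(c * W z ^ (n + 1)) := by
        ext z; simp [hk, sub_eq_add_neg]
      rw [this]
      exact (le_min (ho z hz) ha.meromorphicOrderAt_nonneg).trans
        (meromorphicOrderAt_add (hm z) ha.meromorphicAt)
    obtain ⟨P, hP⟩ := ih hkm hkp hke hko hk0
    refine ⟨P + C c * X ^ (n + 1), ?_⟩
    filter_upwards [hP] with z hz
    simp only [hk] at hz
    simp only [eval_add, eval_mul, eval_C, eval_pow, eval_X]
    linear_combination hz

lemma aux_eval_ne (L : PeriodPair) {Q : ℂ[X]} (hQ : Q ≠ 0) :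
    ∀ᶠ z in codiscreteWithin (Set.univ : Set ℂ), Q.eval (L.weierstrassP z) ≠ 0 := by
  have h1 : ∀ r : ℂ, ∀ᶠ z in codiscreteWithin (Set.univ : Set ℂ), L.weierstrassP z ≠ r := by
    intro r
    have hm : Meromorphic (L.weierstrassP + fun _ => -r) := by
      intro z; exact (L.meromorphic_weierstrassP z).add (by fun_prop)
    have hmo : MeromorphicOn (L.weierstrassP + fun _ => -r) Set.univ := fun z _ => hm z
    have h0 : meromorphicOrderAt (L.weierstrassP + fun _ => -r) 0 ≠ ⊤ := by
      rw [meromorphicOrderAt_add_eq_left_of_lt (by fun_prop),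
        L.order_weierstrassP 0 (zero_mem _)]
      · exact WithTop.coe_ne_top (a := (-2 : ℤ))
      · rw [L.order_weierstrassP 0 (zero_mem _)]
        refine lt_of_lt_of_le ?_
          (AnalyticAt.meromorphicOrderAt_nonneg (f := fun _ : ℂ => -r) (by fun_prop))
        exact WithTop.coe_lt_coe.2 (show (-2 : ℤ) < 0 by norm_num)
    filter_upwards [hmo.eventually_codiscreteWithin_apply_ne_zero (fun x hx =>
      hmo.meromorphicOrderAt_ne_top_of_isPreconnected isPreconnected_univ
        (Set.mem_univ 0) hx h0)] with z hz hzr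
    apply hz
    simp [hzr]
  have h2 : ∀ᶠ z in codiscreteWithin (Set.univ : Set ℂ), ∀ r ∈ Q.roots.toFinset,
      L.weierstrassP z ≠ r := by
    rw [Finset.eventually_all]
    exact fun r _ => h1 r
  filter_upwards [h2] with z hz h0
  exact hz _ (by simp [hQ, h0]) rfl

lemma aux_clear {L : PeriodPair} {h : ℂ → ℂ} (hm : Meromorphic h)
    (hp : ∀ z, ∀ l ∈ L.lattice, h (z + l) = h z) :
    ∃ Q : ℂ[X], Q ≠ 0 ∧ ∀ z ∉ L.lattice,
      0 ≤ meromorphicOrderAt (fun z => Q.eval (L.weierstrassP z) * h z) z := by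
  classical
  have hmo : MeromorphicOn h Set.univ := fun z _ => hm z
  set K := closure (ZSpan.fundamentalDomain L.basis) with hK
  have hKc : IsCompact K := (ZSpan.fundamentalDomain_isBounded L.basis).isCompact_closure
  have hfin : (K \ {x | AnalyticAt ℂ h x}).Finite :=
    hKc.finite_sdiff_of_mem_codiscreteWithin
      (codiscreteWithin_mono (Set.subset_univ _) hmo.analyticAt_mem_codiscreteWithin)
  set F := hfin.toFinset with hF
  set N : ℂ → ℕ := fun a => (-(meromorphicOrderAt h a).untop₀).toNat with hN
  refine ⟨∏ a ∈ F, (X - C (L.weierstrassP a)) ^ N a, ?_, ?_⟩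
  · exact Finset.prod_ne_zero_iff.2 fun a _ => pow_ne_zero _ (X_sub_C_ne_zero _)
  set Q := ∏ a ∈ F, (X - C (L.weierstrassP a)) ^ N a with hQ
  intro b hb
  set a := ZSpan.fract L.basis b with ha
  have hl : ((ZSpan.floor L.basis b : _) : ℂ) ∈ L.lattice := by
    rw [L.lattice_eq_span_range_basis]; exact (ZSpan.floor L.basis b).2
  have hab : b = a + (ZSpan.floor L.basis b : ℂ) := by
    rw [ha, ZSpan.fract_apply]; ring
  have haK : a ∈ K := subset_closure (ZSpan.fract_mem_fundamentalDomain _ _)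
  have haL : a ∉ L.lattice := fun h' => hb (by rw [hab]; exact add_mem h' hl)
  rw [hab, aux_order_periodic (L := L) ?_ _ _ hl]
  swap
  · intro z l hl
    have := L.weierstrassP_add_coe z ⟨l, hl⟩
    simp only at this
    simp only [hp z l hl, this]
  have hmul : ∀ P : ℂ[X], meromorphicOrderAt (fun z => P.eval (L.weierstrassP z) * h z) a =
      meromorphicOrderAt (fun z => P.eval (L.weierstrassP z)) a + meromorphicOrderAt h a :=
    fun P => meromorphicOrderAt_mul (aux_eval_mero L P a) (hm a)
  have hnn : ∀ P : ℂ[X], 0 ≤ meromorphicOrderAt (fun z => P.eval (L.weierstrassP z)) a :=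
    fun P => (aux_eval_analytic L P a haL).meromorphicOrderAt_nonneg
  by_cases haF : a ∈ F
  · rw [hmul]
    have hsplit : (fun z => Q.eval (L.weierstrassP z)) =
        (fun z => (X - C (L.weierstrassP a)).eval (L.weierstrassP z)) ^ N a *
        (fun z => (∏ x ∈ F.erase a, (X - C (L.weierstrassP x)) ^ N x).eval (L.weierstrassP z)) := by
      ext z
      rw [hQ, ← Finset.mul_prod_erase _ _ haF]
      simp only [eval_mul, eval_pow, Pi.mul_apply, Pi.pow_apply]
    have h1 : 1 ≤ meromorphicOrderAt
        (fun z => (X - C (L.weierstrassP a)).eval (L.weierstrassP z)) a := by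
      have han := aux_eval_analytic L (X - C (L.weierstrassP a)) a haL
      have hpos : 0 < meromorphicOrderAt
          (fun z => (X - C (L.weierstrassP a)).eval (L.weierstrassP z)) a := by
        rw [← tendsto_zero_iff_meromorphicOrderAt_pos han.meromorphicAt]
        have := han.continuousAt.tendsto.mono_left (nhdsWithin_le_nhds (s := {a}ᶜ))
        simpa using this
      generalize meromorphicOrderAt
          (fun z => (X - C (L.weierstrassP a)).eval (L.weierstrassP z)) a = o at hpos
      cases o with
      | top => simp
      | coe o => norm_cast at hpos ⊢
    rw [hsplit, meromorphicOrderAt_mul ((aux_eval_mero L _ a).pow _) (aux_eval_mero L _ a),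
      meromorphicOrderAt_pow (aux_eval_mero L _ a)]
    have h2 := hnn (∏ x ∈ F.erase a, (X - C (L.weierstrassP x)) ^ N x)
    have h3 : N a = (-(meromorphicOrderAt h a).untop₀).toNat := rfl
    generalize meromorphicOrderAt
      (fun z => (X - C (L.weierstrassP a)).eval (L.weierstrassP z)) a = o1 at *
    generalize meromorphicOrderAt (fun z =>
      (∏ x ∈ F.erase a, (X - C (L.weierstrassP x)) ^ N x).eval (L.weierstrassP z)) a = o2 at *
    generalize meromorphicOrderAt h a = o3 at *
    generalize N a = M at *
    cases o3 with
    | top => simp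
    | coe o3 =>
    have h4 : ((M : ℤ) : WithTop ℤ) ≤ (M : WithTop ℤ) * o1 := by
      cases o1 with
      | top =>
        rcases Nat.eq_zero_or_pos M with hM | hM
        · simp [hM]
        · rw [WithTop.mul_top (by exact_mod_cast hM.ne')]
          exact le_top
      | coe o1 =>
        have h1' : (1 : ℤ) ≤ o1 := by exact_mod_cast h1
        have : (M : ℤ) ≤ M * o1 := by nlinarith
        exact_mod_cast this
    have h5 : (0 : WithTop ℤ) ≤ ((M : ℤ) : WithTop ℤ) + 0 + (o3 : WithTop ℤ) := by
      rw [WithTop.untop₀_coe] at h3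
      rw [add_zero]
      norm_cast
      change (0 : ℤ) ≤ _
      omega
    refine h5.trans ?_
    gcongr
  · have haa : AnalyticAt ℂ h a := by
      by_contra hcon
      exact haF (by simp [hF, haK, hcon])
    rw [hmul]
    exact add_nonneg (hnn _) haa.meromorphicOrderAt_nonneg

lemma aux_even {L : PeriodPair} {h : ℂ → ℂ} (hm : Meromorphic h)
    (hp : ∀ z, ∀ l ∈ L.lattice, h (z + l) = h z) (he : ∀ z, h (-z) = h z) :
    ∃ R : RatFunc ℂ, ∀ᶠ z in codiscreteWithin (Set.univ : Set ℂ),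
      h z = RatFunc.eval (RingHom.id ℂ) (L.weierstrassP z) R := by
  obtain ⟨Q, hQ, hQo⟩ := aux_clear hm hp
  have hqm : Meromorphic (fun z => Q.eval (L.weierstrassP z) * h z) :=
    fun z => (aux_eval_mero L Q z).mul (hm z)
  obtain ⟨n, hn⟩ : ∃ n : ℕ, ((-(2 * n) : ℤ) : WithTop ℤ) ≤
      meromorphicOrderAt (fun z => Q.eval (L.weierstrassP z) * h z) 0 := by
    generalize meromorphicOrderAt (fun z => Q.eval (L.weierstrassP z) * h z) 0 = o
    cases o with
    | top => exact ⟨0, by simp⟩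
    | coe o =>
      refine ⟨o.natAbs, ?_⟩
      rw [WithTop.coe_le_coe]
      omega
  obtain ⟨P, hP⟩ := aux_poly n hqm (by
    intro z l hl
    have := L.weierstrassP_add_coe z ⟨l, hl⟩
    simp only at this
    simp only [hp z l hl, this]) (fun z => by simp [he]) hQo hn
  refine ⟨algebraMap _ _ P / algebraMap _ _ Q, ?_⟩
  filter_upwards [hP, aux_eval_ne L hQ] with z h1 h2
  set R : RatFunc ℂ := algebraMap _ _ P / algebraMap _ _ Q with hR
  have hd : R.denom.eval (L.weierstrassP z) ≠ 0 := by
    intro h0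
    obtain ⟨S, hS⟩ := RatFunc.denom_div_dvd P Q
    apply h2
    rw [hS, eval_mul, ← hR, h0, zero_mul]
  have hnd : R.num * Q = P * R.denom := by
    exact (RatFunc.num_mul_eq_mul_denom_iff hQ).2 hR
  have hnd' := congrArg (Polynomial.eval (L.weierstrassP z)) hnd
  simp only [eval_mul] at hnd'
  rw [RatFunc.eval, eval₂_id, eval₂_id, eq_div_iff hd]
  apply mul_left_cancel₀ h2
  linear_combination R.denom.eval (L.weierstrassP z) * h1 - hnd'

theorem elliptic_eq_rational_comb_of_wp
    (ω₁ ω₂ : ℂ) (hind : LinearIndependent ℝ ![ω₁, ω₂])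
    (f : ℂ → ℂ) (hmero : MeromorphicOn f Set.univ)
    (hper₁ : ∀ z, f (z + ω₁) = f z) (hper₂ : ∀ z, f (z + ω₂) = f z) :
    ∃ R₁ R₂ : RatFunc ℂ, ∃ S : Set ℂ, S.Countable ∧
      ∀ z ∉ S, f z =
        RatFunc.eval (RingHom.id ℂ) (wp ω₁ ω₂ z) R₁ +
          deriv (wp ω₁ ω₂) z * RatFunc.eval (RingHom.id ℂ) (wp ω₁ ω₂ z) R₂ := by
  let L : PeriodPair := ⟨ω₁, ω₂, hind⟩
  have hwp : wp ω₁ ω₂ = L.weierstrassP := aux_wp_eq L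
  rw [hwp, L.deriv_weierstrassP]
  have hm : Meromorphic f := fun z => hmero z (Set.mem_univ z)
  have hp : ∀ z, ∀ l ∈ L.lattice, f (z + l) = f z := by
    intro z l hl
    obtain ⟨m, n, rfl⟩ := PeriodPair.mem_lattice.1 hl
    have p1 : Function.Periodic f ω₁ := hper₁
    have p2 : Function.Periodic f ω₂ := hper₂
    rw [← add_assoc, (p2.int_mul n) _, (p1.int_mul m) _]
  have hmn : Meromorphic (fun z => f (-z)) := fun z =>
    (hm (-z)).comp_analyticAt (g := fun z => -z) (by fun_prop)
  have hpn : ∀ z, ∀ l ∈ L.lattice, f (-(z + l)) = f (-z) := by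
    intro z l hl
    rw [neg_add]
    exact hp _ _ (neg_mem hl)
  have hDm := L.meromorphic_derivWeierstrassP
  obtain ⟨R₁, h₁⟩ := aux_even (L := L) (h := fun z => (f z + f (-z)) / 2)
    (fun z => by have := hm z; have := hmn z; fun_prop)
    (fun z l hl => by simp only [hp z l hl, hpn z l hl]) (fun z => by simp [add_comm])
  obtain ⟨R₂, h₂⟩ := aux_even (L := L) (h := fun z => (f z - f (-z)) / 2 / L.derivWeierstrassP z)
    (fun z => by have := hm z; have := hmn z; have := hDm z; fun_prop)
    (fun z l hl => by
      have := L.derivWeierstrassP_add_coe z ⟨l, hl⟩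
      simp only at this
      simp only [hp z l hl, hpn z l hl, this])
    (fun z => by
      simp only [neg_neg, PeriodPair.derivWeierstrassP_neg]
      rw [div_neg, ← neg_div]; congr 1; ring)
  have hDmo : MeromorphicOn L.derivWeierstrassP Set.univ := fun z _ => hDm z
  have hD0 : meromorphicOrderAt L.derivWeierstrassP 0 ≠ ⊤ := by
    rw [← L.deriv_weierstrassP, meromorphicOrderAt_deriv_eq_sub_one (n := -2) (by norm_num)
      (L.order_weierstrassP 0 (zero_mem _))]
    exact WithTop.coe_ne_top
  have hD := hDmo.eventually_codiscreteWithin_apply_ne_zero (fun x hx =>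
      hDmo.meromorphicOrderAt_ne_top_of_isPreconnected isPreconnected_univ
        (Set.mem_univ 0) hx hD0)
  have hall := h₁.and (h₂.and hD)
  refine ⟨R₁, R₂, _, aux_countable_compl hall, ?_⟩
  intro z hz
  rw [Set.notMem_compl_iff] at hz
  obtain ⟨e1, e2, e3⟩ := hz
  rw [← e1, ← e2]
  field_simp
  ring
end

section
/- Let f(z) = P(z)/Q(z) be a rational function with P, Q coprime polynomials, deg P < deg Q = N. Then the density ρ_f = 4|f′|²/(1+|f|²)² extends continuously to ℝ² ≅ ℂ (including at the poles of f), is bounded, and is integrable with (1/2π)∫_{ℝ²} ρ_f d²x = 2N. -/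
open MeasureTheory
open Filter Topology Complex ComplexConjugate

def HasWirt (f : ℂ → ℂ) (a b z : ℂ) : Prop :=
  HasFDerivAt f (a • (1 : ℂ →L[ℝ] ℂ) + b • (Complex.conjCLE : ℂ →L[ℝ] ℂ)) z

lemma HasWirt.of_hasDerivAt {f : ℂ → ℂ} {a z : ℂ} (h : HasDerivAt f a z) : HasWirt f a 0 z := by
  unfold HasWirt
  refine h.complexToReal_fderiv.congr_fderiv ?_
  ext v
  simp

lemma HasWirt.conj {f : ℂ → ℂ} {a b z : ℂ} (h : HasWirt f a b z) :
    HasWirt (fun z => conj (f z)) (conj b) (conj a) z := by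
  unfold HasWirt at *
  have := (Complex.conjCLE : ℂ →L[ℝ] ℂ).hasFDerivAt.comp z h
  refine this.congr_fderiv ?_
  ext v
  simp
  ring

lemma HasWirt.add {f g : ℂ → ℂ} {a b c d z : ℂ} (h : HasWirt f a b z) (k : HasWirt g c d z) :
    HasWirt (fun z => f z + g z) (a + c) (b + d) z := by
  unfold HasWirt at *
  refine (HasFDerivAt.add h k).congr_fderiv ?_
  ext v
  simp
  ring

lemma HasWirt.sub {f g : ℂ → ℂ} {a b c d z : ℂ} (h : HasWirt f a b z) (k : HasWirt g c d z) :
    HasWirt (fun z => f z - g z) (a - c) (b - d) z := by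
  unfold HasWirt at *
  refine (HasFDerivAt.sub h k).congr_fderiv ?_
  ext v
  simp
  ring

lemma HasWirt.mul {f g : ℂ → ℂ} {a b c d z : ℂ} (h : HasWirt f a b z) (k : HasWirt g c d z) :
    HasWirt (fun z => f z * g z) (a * g z + f z * c) (b * g z + f z * d) z := by
  unfold HasWirt at *
  refine (HasFDerivAt.mul h k).congr_fderiv ?_
  ext v
  simp
  ring

lemma HasWirt.inv {f : ℂ → ℂ} {a b z : ℂ} (h : HasWirt f a b z) (h0 : f z ≠ 0) :
    HasWirt (fun z => (f z)⁻¹) (-a / f z ^ 2) (-b / f z ^ 2) z := by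
  unfold HasWirt at *
  have := (hasDerivAt_inv h0).complexToReal_fderiv.comp z h
  refine this.congr_fderiv ?_
  ext v
  simp
  ring

lemma iter_eq (b : ℂ → ℂ) (hb : Continuous b) (R : ℝ) (hR : 0 ≤ R) :
    ∫ x : ℝ in (-R)..R, ∫ y : ℝ in (-R)..R, b (x + y * I) =
      ∫ z in (Set.Ioc (-R) R ×ℂ Set.Ioc (-R) R), b z := by
  have hle : -R ≤ R := by linarith
  rw [← (Complex.volume_preserving_equiv_real_prod.symm).setIntegral_preimage_emb
    measurableEquivRealProd.symm.measurableEmbedding]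
  have : (measurableEquivRealProd.symm ⁻¹' (Set.Ioc (-R) R ×ℂ Set.Ioc (-R) R)) =
    Set.Ioc (-R) R ×ˢ Set.Ioc (-R) R := by
    ext p
    simp [Complex.mem_reProdIm, measurableEquivRealProd]
  rw [this, Measure.volume_eq_prod, setIntegral_prod]
  · have e : ∀ x y : ℝ, (x : ℂ) + y * I = measurableEquivRealProd.symm (x, y) :=
      fun x y => (mk_eq_add_mul_I x y).symm
    simp only [intervalIntegral.integral_of_le hle, e]
  · have hc : Continuous fun p : ℝ × ℝ => b (measurableEquivRealProd.symm p) := by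
      have : (fun p : ℝ × ℝ => b (measurableEquivRealProd.symm p)) =
        fun p => b (equivRealProdCLM.symm p) := by
        ext p; rfl
      rw [this]
      fun_prop
    refine (hc.continuousOn.integrableOn_compact (isCompact_Icc.prod isCompact_Icc :
      IsCompact (Set.Icc (-R) R ×ˢ Set.Icc (-R) R))).mono_set ?_
    exact Set.prod_mono Set.Ioc_subset_Icc_self Set.Ioc_subset_Icc_self

lemma green (h b : ℂ → ℂ) (hb : Continuous b) (a : ℂ → ℂ) (hw : ∀ z, HasWirt h (a z) (b z) z)
    (hlim : Tendsto (fun z => z * h z) (cocompact ℂ) (𝓝 0)) :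
    Tendsto (fun R : ℝ => ∫ z in (Set.Ioc (-R) R ×ℂ Set.Ioc (-R) R), b z) atTop (𝓝 0) := by
  have hc : Continuous h := by
    rw [continuous_iff_continuousAt]
    intro z
    exact HasFDerivAt.continuousAt (hw z)
  rw [Metric.tendsto_nhds]
  intro ε hε
  have h1 : ∀ᶠ z in cocompact ℂ, ‖z * h z‖ < ε / 8 := by
    have := (Metric.tendsto_nhds.1 hlim) (ε / 8) (by positivity)
    simpa using this
  rw [← Metric.cobounded_eq_cocompact] at h1
  obtain ⟨M, -, hM⟩ := (hasBasis_cobounded_norm.eventually_iff).1 h1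
  filter_upwards [eventually_ge_atTop M, eventually_gt_atTop 0] with R hRM hR
  have key : ∀ z : ℂ, R ≤ ‖z‖ → ‖h z‖ ≤ ε / 8 / R := by
    intro z hz
    have := hM (show M ≤ ‖z‖ by linarith)
    rw [norm_mul] at this
    rw [le_div_iff₀ hR]
    nlinarith [norm_nonneg (h z)]
  have G := integral_boundary_rect_of_continuousOn_of_hasFDerivAt_real h
    (fun z => a z • (1 : ℂ →L[ℝ] ℂ) + b z • (Complex.conjCLE : ℂ →L[ℝ] ℂ))
    (-R - R * I) (R + R * I) hc.continuousOn (fun z _ => hw z)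
  have e : ∀ z, (I • (a z • (1 : ℂ →L[ℝ] ℂ) + b z • (Complex.conjCLE : ℂ →L[ℝ] ℂ)) 1 -
      (a z • (1 : ℂ →L[ℝ] ℂ) + b z • (Complex.conjCLE : ℂ →L[ℝ] ℂ)) I) = 2 * I * b z := by
    intro z
    simp
    ring
  simp only [e] at G
  specialize G (by
    refine ContinuousOn.integrableOn_compact ?_ ?_
    · exact isCompact_uIcc.reProdIm isCompact_uIcc
    · fun_prop)
  simp only [sub_re, neg_re, ofReal_re, mul_re, I_re, mul_zero, ofReal_im, I_im, mul_one, sub_self,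
    sub_im, neg_im, mul_im, add_re, add_im, neg_zero, zero_sub, sub_zero, add_zero, zero_add] at G
  simp only [intervalIntegral.integral_const_mul] at G
  rw [iter_eq b hb R hR.le] at G
  have hbd : ∀ u : ℝ → ℂ, (∀ x, R ≤ ‖u x‖) → ‖∫ x in (-R)..R, h (u x)‖ ≤ ε / 4 := by
    intro u hu
    refine (intervalIntegral.norm_integral_le_of_norm_le_const
      (fun x _ => key (u x) (hu x))).trans ?_
    rw [abs_of_nonneg (by linarith)]
    apply le_of_eq
    field_simp
    ring
  have him : ∀ x : ℝ, ∀ S : ℝ, |S| = R → R ≤ ‖(x : ℂ) + S * I‖ := by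
    intro x S hS
    have := abs_im_le_norm ((x : ℂ) + S * I)
    simpa [hS] using this
  have hre : ∀ x : ℝ, ∀ S : ℝ, |S| = R → R ≤ ‖(S : ℂ) + x * I‖ := by
    intro x S hS
    have := abs_re_le_norm ((S : ℂ) + x * I)
    simpa [hS] using this
  have a1 : |(-R)| = R := by rw [abs_neg, abs_of_pos hR]
  have a2 : |R| = R := abs_of_pos hR
  have b1 := hbd _ (fun x => him x (-R) a1)
  have b2 := hbd _ (fun x => him x R a2)
  have b3 := hbd _ (fun x => hre x (-R) a1)
  have b4 := hbd _ (fun x => hre x R a2)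
  set J := ∫ z in (Set.Ioc (-R) R ×ℂ Set.Ioc (-R) R), b z
  have n1 : ‖2 * I * J‖ = 2 * ‖J‖ := by simp
  rw [dist_zero_right]
  rw [← G] at n1
  have n2 : 2 * ‖J‖ ≤ ε / 4 + ε / 4 + ε / 4 + ε / 4 := by
    rw [← n1]
    refine (norm_sub_le _ _).trans (add_le_add ((norm_add_le _ _).trans (add_le_add
      ((norm_sub_le _ _).trans (add_le_add b1 b2)) ?_)) ?_)
    · simpa using b4
    · simpa using b3
  linarith

lemma cover : AECover (volume : Measure ℂ) atTop
    (fun R : ℝ => (Set.Ioc (-R) R ×ℂ Set.Ioc (-R) R)) where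
  ae_eventually_mem := by
    refine ae_of_all _ fun z => ?_
    filter_upwards [eventually_gt_atTop ‖z‖] with R hR
    have h1 := abs_lt.1 ((abs_re_le_norm z).trans_lt hR)
    have h2 := abs_lt.1 ((abs_im_le_norm z).trans_lt hR)
    exact ⟨⟨h1.1, h1.2.le⟩, ⟨h2.1, h2.2.le⟩⟩
  measurableSet := fun R => MeasurableSet.inter (measurable_re measurableSet_Ioc)
    (measurable_im measurableSet_Ioc)

lemma model_int : Integrable (fun z : ℂ => 1 / (1 + ‖z‖ ^ 2) ^ 2) := by
  have := integrable_rpow_neg_one_add_norm_sq (E := ℂ) (μ := volume) (r := 4) (by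
    rw [Complex.finrank_real_complex]; norm_num)
  refine this.congr (ae_of_all _ fun z => ?_)
  have : (0:ℝ) ≤ 1 + ‖z‖ ^ 2 := by positivity
  simp only
  rw [show (-4 / 2 : ℝ) = -(2:ℕ) by norm_num, Real.rpow_neg this, Real.rpow_natCast, one_div]

lemma model_val : ∫ z : ℂ, 1 / (1 + ‖z‖ ^ 2) ^ 2 = Real.pi := by
  rw [← Complex.integral_comp_polarCoord_symm]
  have hrad : IntegrableOn (fun r : ℝ => r / (1 + r ^ 2) ^ 2) (Set.Ioi 0) ∧
      ∫ r in Set.Ioi (0:ℝ), r / (1 + r ^ 2) ^ 2 = 1 / 2 := by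
    have hd : ∀ x ∈ Set.Ici (0:ℝ), HasDerivAt (fun r : ℝ => -(1/2) * (1 + r ^ 2)⁻¹)
        (x / (1 + x ^ 2) ^ 2) x := by
      intro x _
      have h0 : (1 + x ^ 2) ≠ 0 := by positivity
      have := (((hasDerivAt_pow 2 x).const_add 1).inv h0).const_mul (-(1/2))
      refine this.congr_deriv ?_
      field_simp
      simp
    have ht : Tendsto (fun r : ℝ => -(1/2) * (1 + r ^ 2)⁻¹) atTop (𝓝 0) := by
      have : Tendsto (fun r : ℝ => 1 + r ^ 2) atTop atTop :=
        tendsto_atTop_add_const_left _ _ (tendsto_pow_atTop two_ne_zero)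
      simpa using this.inv_tendsto_atTop.const_mul (-(1/2 : ℝ))
    have hi := integrableOn_Ioi_deriv_of_nonneg' hd (fun x hx => by
      have : (0:ℝ) < x := hx
      positivity) ht
    refine ⟨hi, ?_⟩
    rw [integral_Ioi_of_hasDerivAt_of_tendsto' hd hi ht]
    norm_num
  have : ∀ p ∈ polarCoord.target, p.1 • (1 / (1 + ‖Complex.polarCoord.symm p‖ ^ 2) ^ 2) =
      (p.1 / (1 + p.1 ^ 2) ^ 2) * 1 := by
    intro p hp
    simp [div_eq_mul_inv]
  rw [setIntegral_congr_fun (by exact polarCoord.open_target.measurableSet) this]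
  rw [polarCoord_target, Measure.volume_eq_prod,
    setIntegral_prod_mul (fun r : ℝ => r / (1 + r ^ 2) ^ 2) (fun _ => (1:ℝ)), hrad.2]
  simp
  rw [max_eq_left (by positivity)]
  ring

lemma poly_lim (A : Polynomial ℂ) (N : ℕ) (hA : A.natDegree ≤ N) :
    Tendsto (fun z => A.eval z / z ^ N) (cocompact ℂ) (𝓝 (A.coeff N)) := by
  have hinv : Tendsto (fun z : ℂ => z⁻¹) (cocompact ℂ) (𝓝 0) := by
    rw [← Metric.cobounded_eq_cocompact]; exact tendsto_inv₀_cobounded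
  have hne : ∀ᶠ z : ℂ in cocompact ℂ, z ≠ 0 := by
    have := (isCompact_singleton (x := (0:ℂ))).compl_mem_cocompact
    filter_upwards [this] with z hz using hz
  have h1 : Tendsto (fun z : ℂ => ∑ i ∈ Finset.range (N + 1), A.coeff i * z⁻¹ ^ (N - i))
      (cocompact ℂ) (𝓝 (∑ i ∈ Finset.range (N + 1), A.coeff i * 0 ^ (N - i))) :=
    tendsto_finsetSum _ fun i _ => (hinv.pow _).const_mul _
  have h2 : (∑ i ∈ Finset.range (N + 1), A.coeff i * 0 ^ (N - i)) = A.coeff N := by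
    rw [Finset.sum_eq_single N]
    · simp
    · intro i hi hiN
      have := Finset.mem_range.1 hi
      rw [zero_pow (by omega), mul_zero]
    · simp
  rw [h2] at h1
  refine h1.congr' ?_
  filter_upwards [hne] with z hz
  rw [Polynomial.eval_eq_sum_range' (n := N + 1) (by omega), Finset.sum_div]
  refine Finset.sum_congr rfl fun i hi => ?_
  have := Finset.mem_range.1 hi
  have e : z ^ N = z ^ (N - i) * z ^ i := by rw [← pow_add]; congr 1; omega
  rw [e, inv_pow]
  field_simp

lemma HasWirt.congr_right {f : ℂ → ℂ} {a b b' z : ℂ} (h : HasWirt f a b z) (e : b = b') :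
    HasWirt f a b' z := e ▸ h

lemma poly_ratio (A Q : Polynomial ℂ) (hQ : Q ≠ 0) (hA : A.natDegree ≤ Q.natDegree) :
    Tendsto (fun z => A.eval z / Q.eval z) (cocompact ℂ)
      (𝓝 (A.coeff Q.natDegree / Q.leadingCoeff)) := by
  have h1 := poly_lim A _ hA
  have h2 := poly_lim Q _ le_rfl
  have hne : ∀ᶠ z : ℂ in cocompact ℂ, z ≠ 0 := by
    have := (isCompact_singleton (x := (0:ℂ))).compl_mem_cocompact
    filter_upwards [this] with z hz using hz
  refine (h1.div h2 (by simpa using hQ)).congr' ?_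
  filter_upwards [hne] with z hz
  have : z ^ Q.natDegree ≠ 0 := pow_ne_zero _ hz
  exact div_div_div_cancel_right₀ this _ _

theorem rational_density_flux
    (P Q : Polynomial ℂ) (hcop : IsCoprime P Q) (N : ℕ) (hN : 1 ≤ N)
    (hdeg : P.degree < Q.degree) (hQdeg : Q.natDegree = N)
    (f : ℂ → ℂ) (hf : ∀ z, f z = P.eval z / Q.eval z) :
    ∃ ρ : ℂ → ℝ, Continuous ρ ∧
      (∀ z, Q.eval z ≠ 0 → ρ z = 4 * ‖deriv f z‖ ^ 2 / (1 + ‖f z‖ ^ 2) ^ 2) ∧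
      (∃ C : ℝ, ∀ z, ρ z ≤ C) ∧
      Integrable ρ ∧
      (1 / (2 * Real.pi)) * ∫ z : ℂ, ρ z = 2 * N := by
  have hQ0 : Q ≠ 0 := by
    rintro rfl
    simp at hQdeg
    omega
  -- positivity of the denominator
  have hpos : ∀ z, 0 < ‖P.eval z‖ ^ 2 + ‖Q.eval z‖ ^ 2 := by
    intro z
    obtain ⟨u, v, huv⟩ := hcop
    have h1 := congrArg (Polynomial.eval z) huv
    simp only [Polynomial.eval_add, Polynomial.eval_mul, Polynomial.eval_one] at h1
    by_cases hp : P.eval z = 0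
    · have : Q.eval z ≠ 0 := by
        intro hq
        simp [hp, hq] at h1
      positivity
    · positivity
  set W : ℂ → ℂ := fun z => P.derivative.eval z * Q.eval z - P.eval z * Q.derivative.eval z with hW
  set ρ : ℂ → ℝ := fun z => 4 * ‖W z‖ ^ 2 / (‖P.eval z‖ ^ 2 + ‖Q.eval z‖ ^ 2) ^ 2 with hρ
  have hWc : Continuous W := by fun_prop
  have hρc : Continuous ρ := by
    refine Continuous.div (by fun_prop) (by fun_prop) fun z => ?_
    exact (pow_pos (hpos z) 2).ne'
  -- asymptotics
  have hXP : (Polynomial.X * P.derivative).natDegree ≤ N - 1 := by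
    have h0 : P.natDegree ≤ N - 1 := by
      by_cases hP : P = 0
      · simp [hP]
      · have := Polynomial.natDegree_lt_natDegree hP hdeg
        omega
    by_cases hP : P.natDegree = 0
    · rw [Polynomial.derivative_of_natDegree_zero hP]; simp
    · refine (Polynomial.natDegree_mul_le).trans ?_
      have := Polynomial.natDegree_derivative_lt hP
      have := Polynomial.natDegree_X_le (R := ℂ)
      omega
  have hP : P.natDegree ≤ N - 1 := by
    by_cases hP : P = 0
    · simp [hP]
    · have := Polynomial.natDegree_lt_natDegree hP hdeg
      omega
  have hXQ : (Polynomial.X * Q.derivative).natDegree ≤ N := by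
    refine (Polynomial.natDegree_mul_le).trans ?_
    have := Polynomial.natDegree_derivative_lt (p := Q) (by omega)
    have := Polynomial.natDegree_X_le (R := ℂ)
    omega
  have L1 : Tendsto (fun z => P.eval z / Q.eval z) (cocompact ℂ) (𝓝 0) := by
    have := poly_ratio P Q hQ0 (by omega)
    rwa [Polynomial.coeff_eq_zero_of_natDegree_lt (by omega), zero_div] at this
  have L2 : Tendsto (fun z => z * P.derivative.eval z / Q.eval z) (cocompact ℂ) (𝓝 0) := by
    have := poly_ratio (Polynomial.X * P.derivative) Q hQ0 (by omega)
    rw [Polynomial.coeff_eq_zero_of_natDegree_lt (by omega), zero_div] at this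
    simpa using this
  have L3 : Tendsto (fun z => z * Q.derivative.eval z / Q.eval z) (cocompact ℂ) (𝓝 N) := by
    have := poly_ratio (Polynomial.X * Q.derivative) Q hQ0 (by omega)
    have e : (Polynomial.X * Q.derivative).coeff Q.natDegree / Q.leadingCoeff = N := by
      obtain ⟨m, hm⟩ : ∃ m, Q.natDegree = m + 1 := ⟨N - 1, by omega⟩
      have hl : Q.leadingCoeff ≠ 0 := by simpa using hQ0
      rw [← hQdeg, Polynomial.leadingCoeff, hm, Polynomial.coeff_X_mul,
        Polynomial.coeff_derivative, ← hm]
      rw [Polynomial.leadingCoeff] at hl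
      rw [mul_div_cancel_left₀ _ hl, hm]
      push_cast
      ring
    rw [e] at this
    simpa using this
  have hinv : Tendsto (fun z : ℂ => z⁻¹) (cocompact ℂ) (𝓝 0) := by
    rw [← Metric.cobounded_eq_cocompact]; exact tendsto_inv₀_cobounded
  have hne : ∀ᶠ z : ℂ in cocompact ℂ, z ≠ 0 := by
    have := (isCompact_singleton (x := (0:ℂ))).compl_mem_cocompact
    filter_upwards [this] with z hz using hz
  have hQne : ∀ᶠ z : ℂ in cocompact ℂ, Q.eval z ≠ 0 := by
    have := (Q.roots.toFinset.finite_toSet.isCompact).compl_mem_cocompact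
    filter_upwards [this] with z hz
    simpa [hQ0] using hz
  -- Wirtinger derivatives
  set g : ℂ → ℂ := fun z => (P.derivative.eval z * conj (P.eval z) +
    Q.derivative.eval z * conj (Q.eval z)) * (P.eval z * conj (P.eval z) +
      Q.eval z * conj (Q.eval z))⁻¹ with hg
  set g0 : ℂ → ℂ := fun z => (N * conj z) * (1 + z * conj z)⁻¹ with hg0
  have hDc : ∀ z, P.eval z * conj (P.eval z) + Q.eval z * conj (Q.eval z) =
      ((‖P.eval z‖ ^ 2 + ‖Q.eval z‖ ^ 2 : ℝ) : ℂ) := by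
    intro z
    rw [mul_conj', mul_conj']; push_cast; rfl
  have hD0 : ∀ z, P.eval z * conj (P.eval z) + Q.eval z * conj (Q.eval z) ≠ 0 := by
    intro z
    rw [hDc]
    exact_mod_cast (hpos z).ne'
  have hEc : ∀ z : ℂ, 1 + z * conj z = ((1 + ‖z‖ ^ 2 : ℝ) : ℂ) := by
    intro z
    rw [mul_conj']; push_cast; rfl
  have hE0 : ∀ z : ℂ, 1 + z * conj z ≠ 0 := by
    intro z
    rw [hEc]
    have : (1 + ‖z‖ ^ 2) ≠ 0 := by positivity
    exact_mod_cast this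
  have wpoly : ∀ (A : Polynomial ℂ) z, HasWirt (fun z => A.eval z) (A.derivative.eval z) 0 z :=
    fun A z => HasWirt.of_hasDerivAt (A.hasDerivAt z)
  have wg : ∀ z, ∃ a, HasWirt g a (ρ z / 4 : ℝ) z := by
    intro z
    have n := ((wpoly P.derivative z).mul (wpoly P z).conj).add
      ((wpoly Q.derivative z).mul (wpoly Q z).conj)
    have d := ((wpoly P z).mul (wpoly P z).conj).add ((wpoly Q z).mul (wpoly Q z).conj)
    have r := n.mul (d.inv (hD0 z))
    refine ⟨_, r.congr_right ?_⟩
    symm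
    have e : ((ρ z / 4 : ℝ) : ℂ) = W z * conj (W z) / (P.eval z * conj (P.eval z) +
      Q.eval z * conj (Q.eval z)) ^ 2 := by
      rw [hDc, mul_conj']
      simp only [hρ]
      push_cast
      ring
    rw [e]
    simp only [hW, map_sub, map_mul]
    have := hD0 z
    field_simp
    ring
  have wg0 : ∀ z, ∃ a, HasWirt g0 a (N * (1 / (1 + ‖z‖ ^ 2) ^ 2) : ℝ) z := by
    intro z
    have i := HasWirt.of_hasDerivAt (hasDerivAt_id z)
    have c := HasWirt.of_hasDerivAt (hasDerivAt_const z (N : ℂ))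
    have c1 := HasWirt.of_hasDerivAt (hasDerivAt_const z (1 : ℂ))
    have d := c1.add (i.mul i.conj)
    have r := (c.mul i.conj).mul (d.inv (hE0 z))
    refine ⟨_, r.congr_right ?_⟩
    symm
    have e : ((N * (1 / (1 + ‖z‖ ^ 2) ^ 2) : ℝ) : ℂ) = N / (1 + z * conj z) ^ 2 := by
      rw [hEc]
      push_cast
      ring
    rw [e]
    have := hE0 z
    simp
    field_simp
    ring
  choose a ha using wg
  choose a0 ha0 using wg0
  -- limits
  have Lg : Tendsto (fun z => z * g z) (cocompact ℂ) (𝓝 N) := by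
    have cj := (Complex.continuous_conj.tendsto (0:ℂ)).comp L1
    have t := ((L2.mul cj).add L3).div ((tendsto_const_nhds (x := (1:ℂ))).add (L1.mul cj)) (by simp)
    have e : ((0 * conj (0:ℂ) + N) / (1 + 0 * conj (0:ℂ)) : ℂ) = N := by simp
    rw [e] at t
    refine t.congr' ?_
    filter_upwards [hQne] with z hz
    have hz' : conj (Q.eval z) ≠ 0 := by simpa using hz
    have h3 := hD0 z
    have h4 : 1 + P.eval z / Q.eval z * (conj (P.eval z) / conj (Q.eval z)) =
      (P.eval z * conj (P.eval z) + Q.eval z * conj (Q.eval z)) / (Q.eval z * conj (Q.eval z)) := by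
      field_simp
      ring
    simp only [Pi.div_apply, Function.comp, map_div₀, hg]
    rw [h4]
    field_simp
  have Lg0 : Tendsto (fun z => z * g0 z) (cocompact ℂ) (𝓝 N) := by
    have cj := (Complex.continuous_conj.tendsto (0:ℂ)).comp hinv
    have t := (tendsto_const_nhds (x := (N:ℂ))).div
      ((tendsto_const_nhds (x := (1:ℂ))).add (hinv.mul cj)) (by simp)
    have e : (N / (1 + 0 * conj (0:ℂ)) : ℂ) = N := by simp
    rw [e] at t
    refine t.congr' ?_
    filter_upwards [hne] with z hz
    have hz' : conj z ≠ 0 := by simpa using hz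
    have h3 := hE0 z
    have h4 : 1 + z⁻¹ * (conj z)⁻¹ = (1 + z * conj z) / (z * conj z) := by
      field_simp
      ring
    simp only [Pi.div_apply, Function.comp, map_inv₀, hg0]
    rw [h4]
    field_simp
  have Lh : Tendsto (fun z => z * (g z - g0 z)) (cocompact ℂ) (𝓝 0) := by
    have := Lg.sub Lg0
    rw [sub_self] at this
    exact this.congr fun z => by ring
  have hm0c : Continuous fun z : ℂ => (N * (1 / (1 + ‖z‖ ^ 2) ^ 2) : ℝ) := by
    refine continuous_const.mul (Continuous.div (by fun_prop) (by fun_prop) fun z => ?_)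
    positivity
  have G := green (fun z => g z - g0 z)
    (fun z => ((ρ z / 4 : ℝ) : ℂ) - ((N * (1 / (1 + ‖z‖ ^ 2) ^ 2) : ℝ) : ℂ))
    (by fun_prop) (fun z => a z - a0 z) (fun z => (ha z).sub (ha0 z)) Lh
  have hion : ∀ (u : ℂ → ℝ), Continuous u → ∀ R : ℝ,
      IntegrableOn u (Set.Ioc (-R) R ×ℂ Set.Ioc (-R) R) := by
    intro u hu R
    refine (hu.continuousOn.integrableOn_compact
      (isCompact_Icc.reProdIm isCompact_Icc : IsCompact (Set.Icc (-R) R ×ℂ Set.Icc (-R) R))).mono_set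
      ?_
    exact fun z hz => ⟨Set.Ioc_subset_Icc_self hz.1, Set.Ioc_subset_Icc_self hz.2⟩
  have T0 := cover.integral_tendsto_of_countably_generated (model_int.const_mul (N : ℝ))
  rw [integral_const_mul, model_val] at T0
  have T1 : Tendsto (fun R : ℝ => ∫ z in (Set.Ioc (-R) R ×ℂ Set.Ioc (-R) R), ρ z) atTop
      (𝓝 (4 * (N * Real.pi))) := by
    have G' := (Complex.continuous_re.tendsto _).comp G
    have := (G'.add T0).const_mul 4
    rw [Complex.zero_re, zero_add] at this
    refine this.congr fun R => ?_
    have e : ∫ z in (Set.Ioc (-R) R ×ℂ Set.Ioc (-R) R),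
        (((ρ z / 4 : ℝ) : ℂ) - ((N * (1 / (1 + ‖z‖ ^ 2) ^ 2) : ℝ) : ℂ)) =
        ((∫ z in (Set.Ioc (-R) R ×ℂ Set.Ioc (-R) R), (ρ z / 4 -
          (N * (1 / (1 + ‖z‖ ^ 2) ^ 2))) : ℝ) : ℂ) := by
      rw [← integral_complex_ofReal]
      simp only [Complex.ofReal_sub]
    simp only [Function.comp]
    rw [e, Complex.ofReal_re, integral_sub (hion _ (by fun_prop) R) (hion _ hm0c R),
      integral_div]
    ring
  have hnn : 0 ≤ᵐ[volume] ρ := ae_of_all _ fun z => by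
    simp only [hρ, Pi.zero_apply]
    positivity
  refine ⟨ρ, hρc, ?_, ?_, ?_, ?_⟩
  · intro z hz
    have hd : deriv f z = W z / Q.eval z ^ 2 := by
      rw [show f = fun z => P.eval z / Q.eval z from funext hf]
      exact ((P.hasDerivAt z).div (Q.hasDerivAt z) hz).deriv
    have hq : ‖Q.eval z‖ ≠ 0 := by simpa using hz
    have hp := (hpos z).ne'
    rw [hd, hf]
    simp only [hρ, norm_div, norm_pow]
    have h4 : 1 + (‖P.eval z‖ / ‖Q.eval z‖) ^ 2 =
      (‖P.eval z‖ ^ 2 + ‖Q.eval z‖ ^ 2) / ‖Q.eval z‖ ^ 2 := by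
      field_simp
      ring
    rw [h4]
    field_simp
  · have t : Tendsto (fun z => z⁻¹ * (z * P.derivative.eval z / Q.eval z -
        P.eval z / Q.eval z * (z * Q.derivative.eval z / Q.eval z))) (cocompact ℂ) (𝓝 0) := by
      simpa using hinv.mul (L2.sub (L1.mul L3))
    have t1 : ∀ᶠ z in cocompact ℂ, ρ z ≤ 4 := by
      have := (Metric.tendsto_nhds.1 t) 1 one_pos
      filter_upwards [this, hne, hQne] with z hz h0 hq
      rw [dist_zero_right] at hz
      have e : z⁻¹ * (z * P.derivative.eval z / Q.eval z -
        P.eval z / Q.eval z * (z * Q.derivative.eval z / Q.eval z)) = W z / Q.eval z ^ 2 := by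
        simp only [hW]
        field_simp
      have hq' : 0 < ‖Q.eval z‖ := by simpa using hq
      rw [e, norm_div, norm_pow, div_lt_one (by positivity)] at hz
      simp only [hρ]
      rw [div_le_iff₀ (pow_pos (hpos z) 2)]
      have : ‖W z‖ ≤ ‖P.eval z‖ ^ 2 + ‖Q.eval z‖ ^ 2 := by nlinarith [sq_nonneg ‖P.eval z‖]
      have := pow_le_pow_left₀ (norm_nonneg _) this 2
      linarith
    obtain ⟨K, hK, hKs⟩ := mem_cocompact.1 t1
    obtain ⟨C, hC⟩ := hK.bddAbove_image hρc.continuousOn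
    refine ⟨max C 4, fun z => ?_⟩
    by_cases hz : z ∈ K
    · exact (hC (Set.mem_image_of_mem _ hz)).trans (le_max_left _ _)
    · exact (hKs hz : ρ z ≤ 4).trans (le_max_right _ _)
  · exact cover.integrable_of_integral_tendsto_of_nonneg_ae _ (hion ρ hρc) hnn T1
  · rw [cover.integral_eq_of_tendsto_of_nonneg_ae _ hnn (hion ρ hρc) T1]
    have := Real.pi_ne_zero
    field_simp
    ring
end
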